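/- Let γ₁, γ₂ ∈ L^∞_loc(ℝ) and define φ : ℝ² → ℝ by φ(t,s) = ∫₀ᵗ γ₁(ξ)dξ + ∫₀ˢ γ₂(ξ)dξ. Suppose the one-sided limits γ₁(t+0), γ₁(t−0) exist at t and γ₂(s+0), γ₂(s−0) exist at s (as limits of the locally essentially bounded functions, i.e. there are right- and left-continuous representatives at these points). Then for every direction (z₁,z₂) ∈ ℝ² the Clarke directional derivative satisfies φ°((t,s);(z₁,z₂)) ≥ γ₁(t±0)z₁ + γ₂(s±0)z₂ for each of the four choices of signs; in particular each of the four points (γ₁(t±0), γ₂(s±0)) belongs to ∂φ(t,s). -/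

import Mathlib

open MeasureTheory Filter

/-- The Clarke generalized directional derivative of `ψ` at `x` in direction `v`. -/
noncomputable def clarkeDeriv {E : Type*} [NormedAddCommGroup E] [NormedSpace ℝ E]
    (ψ : E → ℝ) (x v : E) : ℝ :=
  Filter.limsup (fun p : E × ℝ => (ψ (p.1 + p.2 • v) - ψ p.1) / p.2)
    ((nhds x) ×ˢ (nhdsWithin 0 (Set.Ioi (0 : ℝ))))

/-- The Clarke subdifferential `∂ψ(x) = {ξ ∈ E* : ⟨ξ,v⟩ ≤ ψ°(x;v) for all v ∈ E}`. -/
def clarkeSubdiff {E : Type*} [NormedAddCommGroup E] [NormedSpace ℝ E]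
    (ψ : E → ℝ) (x : E) : Set (E →L[ℝ] ℝ) :=
  {ξ | ∀ v : E, ξ v ≤ clarkeDeriv ψ x v}

/-- `γ(t+0)` exists and equals `L`: for every `ε > 0` there is `δ > 0` with
`|γ(s) − L| < ε` for a.e. `s ∈ (t, t+δ)`. -/
def hasRightLimAe (γ : ℝ → ℝ) (t L : ℝ) : Prop :=
  ∀ ε : ℝ, 0 < ε → ∃ δ : ℝ, 0 < δ ∧
    ∀ᵐ s ∂(volume.restrict (Set.Ioo t (t + δ))), |γ s - L| < ε

/-- `γ(t−0)` exists and equals `L`. -/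
def hasLeftLimAe (γ : ℝ → ℝ) (t L : ℝ) : Prop :=
  ∀ ε : ℝ, 0 < ε → ∃ δ : ℝ, 0 < δ ∧
    ∀ᵐ s ∂(volume.restrict (Set.Ioo (t - δ) t)), |γ s - L| < ε

/-- A measurable, locally essentially bounded function is integrable on every interval. -/
theorem intervalIntegrable_of_locally_ae_bounded {γ : ℝ → ℝ} (hm : Measurable γ)
    (hloc : ∀ R : ℝ, 0 < R →
      ∃ C : ℝ, ∀ᵐ s ∂(volume.restrict (Set.Icc (-R) R)), |γ s| ≤ C) (a b : ℝ) :
    IntervalIntegrable γ volume a b := by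
  obtain ⟨C, hC⟩ := hloc (|a| + |b| + 1) (by positivity)
  have hint : IntegrableOn γ (Set.Icc (-(|a| + |b| + 1)) (|a| + |b| + 1)) volume :=
    Measure.integrableOn_of_bounded (M := C) measure_Icc_lt_top.ne
      hm.aestronglyMeasurable hC
  refine (hint.mono_set ?_).intervalIntegrable
  have ha := abs_le.mp (le_refl |a|)
  have hb := abs_le.mp (le_refl |b|)
  exact Set.uIcc_subset_Icc ⟨by linarith [abs_nonneg b], by linarith [abs_nonneg b]⟩
    ⟨by linarith [abs_nonneg a], by linarith [abs_nonneg a]⟩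

/-- If `γ` is within `ε` of `L` almost everywhere on an interval, increments of its primitive
there are within `ε|y - x|` of the linear ones. -/
theorem abs_integral_sub_le_of_ae {γ : ℝ → ℝ} (hi : ∀ a b, IntervalIntegrable γ volume a b)
    {a b L ε : ℝ} (h : ∀ᵐ r ∂(volume.restrict (Set.Ioo a b)), |γ r - L| ≤ ε)
    {x y : ℝ} (hx : x ∈ Set.Ioo a b) (hy : y ∈ Set.Ioo a b) :
    |(∫ ξ in (0:ℝ)..y, γ ξ) - (∫ ξ in (0:ℝ)..x, γ ξ) - L * (y - x)| ≤ ε * |y - x| := by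
  have heq : (∫ ξ in (0:ℝ)..y, γ ξ) - (∫ ξ in (0:ℝ)..x, γ ξ) - L * (y - x)
      = ∫ ξ in x..y, (γ ξ - L) := by
    rw [intervalIntegral.integral_interval_sub_left (hi 0 y) (hi 0 x),
      intervalIntegral.integral_sub (hi x y) intervalIntegrable_const,
      intervalIntegral.integral_const, smul_eq_mul, mul_comm L]
  rw [heq, ← Real.norm_eq_abs]
  refine intervalIntegral.norm_integral_le_of_norm_le_const_ae ?_
  filter_upwards [(ae_restrict_iff' measurableSet_Ioo).mp h] with r hr hrxy
  exact hr (Set.ordConnected_Ioo.uIcc_subset hx hy (Set.uIoc_subset_uIcc hrxy))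

/-- `γ` is essentially close to `L` on open intervals arbitrarily near `t`. -/
def IsAeLimitAlongIntervals (γ : ℝ → ℝ) (t L : ℝ) : Prop :=
  ∀ ε : ℝ, 0 < ε → ∀ U ∈ nhds t, ∃ a b : ℝ, ∃ w ∈ Set.Ioo a b, w ∈ U ∧
    ∀ᵐ r ∂(volume.restrict (Set.Ioo a b)), |γ r - L| ≤ ε

theorem hasRightLimAe.isAeLimitAlongIntervals {γ : ℝ → ℝ} {t L : ℝ}
    (h : hasRightLimAe γ t L) : IsAeLimitAlongIntervals γ t L := by
  intro ε hε U hU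
  obtain ⟨δ, hδ, hae⟩ := h ε hε
  obtain ⟨w, hwI, hwU⟩ := nonempty_of_mem
    (inter_mem (Ioo_mem_nhdsGT (by linarith : t < t + δ)) (mem_nhdsWithin_of_mem_nhds hU))
  exact ⟨t, t + δ, w, hwI, hwU, hae.mono fun _ hr => hr.le⟩

theorem hasLeftLimAe.isAeLimitAlongIntervals {γ : ℝ → ℝ} {t L : ℝ}
    (h : hasLeftLimAe γ t L) : IsAeLimitAlongIntervals γ t L := by
  intro ε hε U hU
  obtain ⟨δ, hδ, hae⟩ := h ε hε
  obtain ⟨w, hwI, hwU⟩ := nonempty_of_mem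
    (inter_mem (Ioo_mem_nhdsLT (by linarith : t - δ < t)) (mem_nhdsWithin_of_mem_nhds hU))
  exact ⟨t - δ, t, w, hwI, hwU, hae.mono fun _ hr => hr.le⟩

/-- Difference quotients of a primitive of `γ` in direction `z` are eventually close to `L * z`. -/
theorem eventually_abs_primitive_quotient_sub_le {γ : ℝ → ℝ}
    (hi : ∀ a b, IntervalIntegrable γ volume a b) {a b L ε : ℝ}
    (h : ∀ᵐ r ∂(volume.restrict (Set.Ioo a b)), |γ r - L| ≤ ε)
    {x : ℝ} (hx : x ∈ Set.Ioo a b) (z : ℝ) :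
    ∀ᶠ p : ℝ × ℝ in nhds x ×ˢ nhdsWithin 0 (Set.Ioi 0),
      |((∫ ξ in (0:ℝ)..(p.1 + p.2 * z), γ ξ) - ∫ ξ in (0:ℝ)..p.1, γ ξ) / p.2 - L * z|
        ≤ ε * |z| := by
  have htend : Tendsto (fun p : ℝ × ℝ => p.1 + p.2 * z)
      (nhds x ×ˢ nhdsWithin 0 (Set.Ioi 0)) (nhds x) := by
    have hc : Continuous fun p : ℝ × ℝ => p.1 + p.2 * z := by fun_prop
    have h0 := hc.tendsto (x, 0)
    rw [nhds_prod_eq] at h0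
    simpa using h0.mono_left (prod_mono le_rfl nhdsWithin_le_nhds)
  have hI := Ioo_mem_nhds hx.1 hx.2
  filter_upwards [tendsto_fst.eventually hI, htend.eventually hI,
    tendsto_snd.eventually self_mem_nhdsWithin] with p h1 h2 h3
  have hpos : 0 < p.2 := h3
  have key := abs_integral_sub_le_of_ae hi h h1 h2
  rw [add_sub_cancel_left, abs_mul, abs_of_pos hpos] at key
  rw [div_sub' hpos.ne', abs_div, abs_of_pos hpos, div_le_iff₀ hpos]
  calc _ = _ := by congr 1; ring
    _ ≤ _ := key
    _ = _ := by ring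

/-- Essential limits along intervals of `γ₁` and `γ₂` give lower bounds for the Clarke derivative
of the separable primitive. -/
theorem add_mul_le_clarkeDeriv {γ₁ γ₂ : ℝ → ℝ} (hm₁ : Measurable γ₁) (hm₂ : Measurable γ₂)
    (hloc₁ : ∀ R : ℝ, 0 < R →
      ∃ C : ℝ, ∀ᵐ s ∂(volume.restrict (Set.Icc (-R) R)), |γ₁ s| ≤ C)
    (hloc₂ : ∀ R : ℝ, 0 < R →
      ∃ C : ℝ, ∀ᵐ s ∂(volume.restrict (Set.Icc (-R) R)), |γ₂ s| ≤ C)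
    {φ : ℝ × ℝ → ℝ}
    (hφ : ∀ p : ℝ × ℝ, φ p = (∫ ξ in (0:ℝ)..p.1, γ₁ ξ) + ∫ ξ in (0:ℝ)..p.2, γ₂ ξ)
    {t s L M : ℝ} (hL : IsAeLimitAlongIntervals γ₁ t L) (hM : IsAeLimitAlongIntervals γ₂ s M)
    (z₁ z₂ : ℝ) : L * z₁ + M * z₂ ≤ clarkeDeriv φ (t, s) (z₁, z₂) := by
  have hi₁ := intervalIntegrable_of_locally_ae_bounded hm₁ hloc₁
  have hi₂ := intervalIntegrable_of_locally_ae_bounded hm₂ hloc₂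
  have hsplit : ∀ p : (ℝ × ℝ) × ℝ, (φ (p.1 + p.2 • (z₁, z₂)) - φ p.1) / p.2 =
      ((∫ ξ in (0:ℝ)..(p.1.1 + p.2 * z₁), γ₁ ξ) - ∫ ξ in (0:ℝ)..p.1.1, γ₁ ξ) / p.2 +
      ((∫ ξ in (0:ℝ)..(p.1.2 + p.2 * z₂), γ₂ ξ) - ∫ ξ in (0:ℝ)..p.1.2, γ₂ ξ) / p.2 := by
    intro p
    simp only [hφ, Prod.fst_add, Prod.snd_add, Prod.smul_fst, Prod.smul_snd, smul_eq_mul]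
    ring
  have hproj₁ : ∀ w : ℝ × ℝ, Tendsto (fun p : (ℝ × ℝ) × ℝ => (p.1.1, p.2))
      (nhds w ×ˢ nhdsWithin 0 (Set.Ioi 0)) (nhds w.1 ×ˢ nhdsWithin 0 (Set.Ioi 0)) := fun w =>
    ((continuous_fst.tendsto w).comp tendsto_fst).prodMk tendsto_snd
  have hproj₂ : ∀ w : ℝ × ℝ, Tendsto (fun p : (ℝ × ℝ) × ℝ => (p.1.2, p.2))
      (nhds w ×ˢ nhdsWithin 0 (Set.Ioi 0)) (nhds w.2 ×ˢ nhdsWithin 0 (Set.Ioi 0)) := fun w =>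
    ((continuous_snd.tendsto w).comp tendsto_fst).prodMk tendsto_snd
  have hquot : ∀ {a₁ b₁ a₂ b₂ N₁ N₂ ε₁ ε₂ : ℝ} (w : ℝ × ℝ),
      (∀ᵐ r ∂(volume.restrict (Set.Ioo a₁ b₁)), |γ₁ r - N₁| ≤ ε₁) → w.1 ∈ Set.Ioo a₁ b₁ →
      (∀ᵐ r ∂(volume.restrict (Set.Ioo a₂ b₂)), |γ₂ r - N₂| ≤ ε₂) → w.2 ∈ Set.Ioo a₂ b₂ →
      ∀ᶠ p : (ℝ × ℝ) × ℝ in nhds w ×ˢ nhdsWithin 0 (Set.Ioi 0),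
        |(φ (p.1 + p.2 • (z₁, z₂)) - φ p.1) / p.2 - (N₁ * z₁ + N₂ * z₂)|
          ≤ ε₁ * |z₁| + ε₂ * |z₂| := by
    intro a₁ b₁ a₂ b₂ N₁ N₂ ε₁ ε₂ w h₁ hw₁ h₂ hw₂
    filter_upwards [
      (hproj₁ w).eventually (eventually_abs_primitive_quotient_sub_le hi₁ h₁ hw₁ z₁),
      (hproj₂ w).eventually (eventually_abs_primitive_quotient_sub_le hi₂ h₂ hw₂ z₂)]
      with p hp₁ hp₂
    rw [hsplit, add_sub_add_comm]
    exact (abs_add_le _ _).trans (add_le_add hp₁ hp₂)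
  have hbdd : IsBoundedUnder (· ≤ ·) (nhds (t, s) ×ˢ nhdsWithin 0 (Set.Ioi (0 : ℝ)))
      (fun p : (ℝ × ℝ) × ℝ => (φ (p.1 + p.2 • (z₁, z₂)) - φ p.1) / p.2) := by
    have hlocal : ∀ {γ : ℝ → ℝ} (x : ℝ), (∀ R : ℝ, 0 < R →
        ∃ C : ℝ, ∀ᵐ s ∂(volume.restrict (Set.Icc (-R) R)), |γ s| ≤ C) →
        ∃ R C : ℝ, (∀ᵐ r ∂(volume.restrict (Set.Ioo (-R) R)), |γ r - 0| ≤ C) ∧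
          x ∈ Set.Ioo (-R) R := by
      intro γ x hloc
      obtain ⟨C, hC⟩ := hloc (|x| + 1) (by positivity)
      refine ⟨|x| + 1, C, ?_, abs_lt.mp (lt_add_one |x|)⟩
      simpa only [sub_zero] using ae_restrict_of_ae_restrict_of_subset Set.Ioo_subset_Icc_self hC
    obtain ⟨R₁, C₁, hC₁, ht⟩ := hlocal t hloc₁
    obtain ⟨R₂, C₂, hC₂, hs⟩ := hlocal s hloc₂
    refine ⟨C₁ * |z₁| + C₂ * |z₂|, eventually_map.mpr ?_⟩
    filter_upwards [hquot (t, s) hC₁ ht hC₂ hs] with p hp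
    simpa using (le_abs_self _).trans hp
  have happrox : ∀ ε : ℝ, 0 < ε →
      L * z₁ + M * z₂ - ε * (|z₁| + |z₂|) ≤ clarkeDeriv φ (t, s) (z₁, z₂) := by
    intro ε hε
    refine le_limsup_of_frequently_le (fun hev => ?_) hbdd
    obtain ⟨P, hP, Q, hQ, hPQ⟩ := eventually_prod_iff.mp hev
    rw [nhds_prod_eq] at hP
    obtain ⟨P₁, hP₁, P₂, hP₂, hPP⟩ := eventually_prod_iff.mp hP
    obtain ⟨a₁, b₁, w₁, hw₁, hwP₁, hγ₁⟩ := hL ε hε _ hP₁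
    obtain ⟨a₂, b₂, w₂, hw₂, hwP₂, hγ₂⟩ := hM ε hε _ hP₂
    have hline : Tendsto (fun r : ℝ => ((w₁, w₂), r)) (nhdsWithin 0 (Set.Ioi 0))
        (nhds (w₁, w₂) ×ˢ nhdsWithin 0 (Set.Ioi 0)) :=
      tendsto_const_nhds.prodMk tendsto_id
    obtain ⟨r, hr, hrQ⟩ :=
      ((hline.eventually (hquot (w₁, w₂) hγ₁ hw₁ hγ₂ hw₂)).and hQ).exists
    refine hPQ (hPP hwP₁ hwP₂) hrQ ?_
    linarith [(abs_le.mp hr).1]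
  have hlim : Tendsto (fun ε : ℝ => L * z₁ + M * z₂ - ε * (|z₁| + |z₂|))
      (nhdsWithin 0 (Set.Ioi 0)) (nhds (L * z₁ + M * z₂)) := by
    have hc : Continuous fun ε : ℝ => L * z₁ + M * z₂ - ε * (|z₁| + |z₂|) := by fun_prop
    simpa using (hc.tendsto 0).mono_left nhdsWithin_le_nhds
  refine le_of_tendsto hlim ?_
  filter_upwards [self_mem_nhdsWithin] with ε hε using happrox ε hε

/-- for `γ₁, γ₂ ∈ L^∞_loc(ℝ)`, `φ(t,s) = ∫₀ᵗ γ₁ + ∫₀ˢ γ₂`, if the one-sided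
limits `γ₁(t±0)` and `γ₂(s±0)` exist, then for every direction `(z₁,z₂)` one has
`φ°((t,s);(z₁,z₂)) ≥ γ₁(t±0)z₁ + γ₂(s±0)z₂` for each of the four choices of signs; in
particular each of the four points `(γ₁(t±0), γ₂(s±0))` belongs to `∂φ(t,s)`. -/
theorem stmt9 (γ₁ γ₂ : ℝ → ℝ) (hm₁ : Measurable γ₁) (hm₂ : Measurable γ₂)
    (hloc₁ : ∀ R : ℝ, 0 < R →
      ∃ C : ℝ, ∀ᵐ s ∂(volume.restrict (Set.Icc (-R) R)), |γ₁ s| ≤ C)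
    (hloc₂ : ∀ R : ℝ, 0 < R →
      ∃ C : ℝ, ∀ᵐ s ∂(volume.restrict (Set.Icc (-R) R)), |γ₂ s| ≤ C)
    (φ : ℝ × ℝ → ℝ)
    (hφ : ∀ p : ℝ × ℝ, φ p = (∫ ξ in (0:ℝ)..p.1, γ₁ ξ) + ∫ ξ in (0:ℝ)..p.2, γ₂ ξ)
    (t s L₁p L₁m L₂p L₂m : ℝ)
    (h₁p : hasRightLimAe γ₁ t L₁p) (h₁m : hasLeftLimAe γ₁ t L₁m)
    (h₂p : hasRightLimAe γ₂ s L₂p) (h₂m : hasLeftLimAe γ₂ s L₂m) :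
    ∀ L ∈ ({L₁p, L₁m} : Set ℝ), ∀ M ∈ ({L₂p, L₂m} : Set ℝ),
      (∀ z₁ z₂ : ℝ, L * z₁ + M * z₂ ≤ clarkeDeriv φ (t, s) (z₁, z₂)) ∧
      (L • ContinuousLinearMap.fst ℝ ℝ ℝ + M • ContinuousLinearMap.snd ℝ ℝ ℝ)
        ∈ clarkeSubdiff φ (t, s) := by
  intro L hL M hM
  have hL' : IsAeLimitAlongIntervals γ₁ t L := by
    rcases hL with rfl | rfl
    exacts [h₁p.isAeLimitAlongIntervals, h₁m.isAeLimitAlongIntervals]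
  have hM' : IsAeLimitAlongIntervals γ₂ s M := by
    rcases hM with rfl | rfl
    exacts [h₂p.isAeLimitAlongIntervals, h₂m.isAeLimitAlongIntervals]
  have hle := add_mul_le_clarkeDeriv hm₁ hm₂ hloc₁ hloc₂ hφ hL' hM'
  exact ⟨hle, fun v => by simpa using hle v.1 v.2⟩
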